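/- Let n ≥ 3 be a natural number and define φ on the unit disk 𝔻 by φ(z) = ∫₀¹ z·(1 − (zt)^n)^{−2/n} dt (equivalently, φ is the primitive of (1−ζ^n)^{−2/n} with φ(0) = 0, where the power is the principal branch). Then φ is injective on 𝔻 and its image φ(𝔻) is a convex set (it is the interior of a regular n-gon). -/

import Mathlib

/-- A nonempty open set admitting a supporting functional at each boundary point is convex. -/
theorem IsOpen.convex_of_forall_supporting {E : Type*} [NormedAddCommGroup E] [NormedSpace ℝ E]
    {U : Set E} (hU : IsOpen U)
    (h : ∀ b ∈ closure U, b ∉ U → ∃ f : E →L[ℝ] ℝ, f ≠ 0 ∧ ∀ w ∈ U, f w ≤ f b) :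
    Convex ℝ U := by
  rcases U.eq_empty_or_nonempty with rfl | hne
  · exact convex_empty
  have hsub : convexHull ℝ U ⊆ U := by
    refine (convex_convexHull ℝ U).isPreconnected.subset_of_closure_inter_subset hU ?_ ?_
    · obtain ⟨x, hx⟩ := hne
      exact ⟨x, subset_convexHull ℝ U hx, hx⟩
    · rintro b ⟨hb, hbU⟩
      by_contra hbn
      obtain ⟨f, hf0, hf⟩ := h b hb hbn
      have hle : convexHull ℝ U ⊆ {w | f w ≤ f b} :=
        convexHull_min hf (convex_halfSpace_le f.toLinearMap.isLinear (f b))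
      have hmax : IsLocalMax f b := by
        filter_upwards [hU.convexHull.mem_nhds hbU] with w hw using hle hw
      exact hf0 (hmax.hasFDerivAt_eq_zero f.hasFDerivAt)
  rw [← hsub.antisymm (subset_convexHull ℝ U)]
  exact convex_convexHull ℝ U

/-- A holomorphic function whose real part is bounded by `M` on a circle is bounded by `M`
in the disk. -/
theorem Complex.re_le_of_forall_sphere_re_le {g : ℂ → ℂ} {r M : ℝ} (hr : 0 < r)
    (hg : DifferentiableOn ℂ g (Metric.closedBall 0 r))
    (h : ∀ z ∈ Metric.sphere (0 : ℂ) r, (g z).re ≤ M) {z : ℂ}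
    (hz : z ∈ Metric.ball (0 : ℂ) r) : (g z).re ≤ M := by
  have hd : DiffContOnCl ℂ (fun z => Complex.exp (g z)) (Metric.ball 0 r) := by
    refine DifferentiableOn.diffContOnCl ?_
    rw [closure_ball _ hr.ne']
    exact hg.cexp
  have key := Complex.norm_le_of_forall_mem_frontier_norm_le (C := Real.exp M)
    Metric.isBounded_ball hd ?_ (subset_closure hz)
  · simpa [Complex.norm_exp] using key
  · intro w hw
    rw [frontier_ball _ hr.ne'] at hw
    simpa [Complex.norm_exp] using h w hw

/-- If the tangent angle `α` of a closed plane curve is increasing with total turning `2π`, then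
the curve lies on one side of its tangent; here `g` is a linear functional of the curve. -/
theorem le_of_tangent_angle {g α ρ : ℝ → ℝ} {a : ℝ} (hα : StrictMono α) (hαc : Continuous α)
    (hper : α (a + 2 * Real.pi) = α a + 2 * Real.pi) (hgper : g (a + 2 * Real.pi) = g a)
    (hρ : ∀ t, 0 ≤ ρ t)
    (hg : ∀ t, HasDerivAt g (-(ρ t * Real.sin (α t - α a))) t) {t : ℝ}
    (ht : t ∈ Set.Icc a (a + 2 * Real.pi)) : g t ≤ g a := by
  have hπ := Real.pi_pos
  have hgc : Continuous g := continuous_iff_continuousAt.2 fun t => (hg t).continuousAt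
  obtain ⟨b, hb, hαb⟩ : α a + Real.pi ∈ α '' Set.Icc a (a + 2 * Real.pi) := by
    apply intermediate_value_Icc (by linarith) hαc.continuousOn
    rw [hper]
    constructor <;> linarith
  have hanti : AntitoneOn g (Set.Icc a b) := by
    refine antitoneOn_of_hasDerivWithinAt_nonpos (convex_Icc a b) hgc.continuousOn
      (fun x _ => (hg x).hasDerivWithinAt) fun x hx => ?_
    rw [interior_Icc] at hx
    have h1 := hα hx.1
    have h2 := hα hx.2
    have := Real.sin_nonneg_of_nonneg_of_le_pi (x := α x - α a) (by linarith) (by linarith)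
    have := mul_nonneg (hρ x) this
    linarith
  have hmono : MonotoneOn g (Set.Icc b (a + 2 * Real.pi)) := by
    refine monotoneOn_of_hasDerivWithinAt_nonneg (convex_Icc b _) hgc.continuousOn
      (fun x _ => (hg x).hasDerivWithinAt) fun x hx => ?_
    rw [interior_Icc] at hx
    have h1 := hα hx.1
    have h2 := hα hx.2
    have := Real.sin_nonneg_of_nonneg_of_le_pi (x := α x - α a - Real.pi)
      (by linarith) (by linarith)
    rw [Real.sin_sub_pi] at this
    have := mul_nonneg (hρ x) this
    linarith
  rcases le_total t b with htb | htb
  · exact hanti ⟨le_rfl, hb.1⟩ ⟨ht.1, htb⟩ ht.1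
  · rw [← hgper]
    exact hmono ⟨htb, ht.2⟩ ⟨hb.2, le_rfl⟩ ht.2

open Complex Metric Set Filter Topology

/-- A function with nonvanishing derivative `exp l` on an open set is open there. -/
theorem isOpen_image_of_hasDerivAt_exp {F l : ℂ → ℂ} {s : Set ℂ} (hs : IsOpen s)
    (hF : ∀ z ∈ s, HasDerivAt F (exp (l z)) z) : IsOpen (F '' s) := by
  have hA : DifferentiableOn ℂ F s := fun z hz => (hF z hz).differentiableAt.differentiableWithinAt
  rw [isOpen_iff_mem_nhds]
  rintro _ ⟨z, hz, rfl⟩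
  have hst : HasStrictDerivAt F (exp (l z)) z := by
    have := (hA.analyticAt (hs.mem_nhds hz)).hasStrictDerivAt
    rwa [(hF z hz).deriv] at this
  rw [← hst.map_nhds_eq (exp_ne_zero _)]
  exact image_mem_map (hs.mem_nhds hz)

/-- On a circle `|z| = r`, a function with `F' = exp l` and `Re (1 + z F''/F') > 0` attains the
maximum of a suitable linear functional at any prescribed point. -/
theorem exists_re_mul_le_of_mem_sphere {F l l' : ℂ → ℂ}
    (hF : ∀ z ∈ ball (0 : ℂ) 1, HasDerivAt F (exp (l z)) z)
    (hl : ∀ z ∈ ball (0 : ℂ) 1, HasDerivAt l (l' z) z)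
    (hpos : ∀ z ∈ ball (0 : ℂ) 1, 0 < (1 + z * l' z).re) {r : ℝ} (hr : 0 < r) (hr1 : r < 1)
    {ζ : ℂ} (hζ : ζ ∈ sphere (0 : ℂ) r) :
    ∃ c : ℂ, c ≠ 0 ∧ ∀ z ∈ sphere (0 : ℂ) r, (c * F z).re ≤ (c * F ζ).re := by
  have hcm : ∀ t : ℝ, circleMap 0 r t ∈ ball (0 : ℂ) 1 := fun t => by
    simp [abs_of_pos hr, hr1]
  obtain ⟨a, rfl⟩ : ∃ a : ℝ, circleMap 0 r a = ζ := by
    have : ζ ∈ range (circleMap 0 r) := by rwa [range_circleMap, abs_of_pos hr]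
    exact this
  set α : ℝ → ℝ := fun t => t + (l (circleMap 0 r t)).im with hαdef
  have hαd : ∀ t, HasDerivAt α (1 + circleMap 0 r t * l' (circleMap 0 r t)).re t := fun t => by
    have h1 := (hl _ (hcm t)).comp t (hasDerivAt_circleMap 0 r t)
    have h2 := (imCLM.hasFDerivAt.comp_hasDerivAt t h1)
    refine ((hasDerivAt_id t).add h2).congr_deriv ?_
    simp
    ring
  have hαm : StrictMono α := strictMono_of_deriv_pos fun t => by
    rw [(hαd t).deriv]; exact hpos _ (hcm t)
  have hαc : Continuous α := continuous_iff_continuousAt.2 fun t => (hαd t).continuousAt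
  have hper := periodic_circleMap 0 r a
  refine ⟨exp (-(α a * I)), exp_ne_zero _, fun z hz => ?_⟩
  obtain ⟨t, ht, rfl⟩ : ∃ t ∈ Ico a (a + 2 * Real.pi), circleMap 0 r t = z := by
    obtain ⟨x, rfl⟩ : z ∈ range (circleMap 0 r) := by rwa [range_circleMap, abs_of_pos hr]
    obtain ⟨t, ht, hxt⟩ :=
      Function.Periodic.exists_mem_Ico (periodic_circleMap 0 r) Real.two_pi_pos x a
    exact ⟨t, ht, hxt.symm⟩
  refine le_of_tangent_angle (g := fun t => (exp (-(α a * I)) * F (circleMap 0 r t)).re)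
    (ρ := fun t => r * Real.exp (l (circleMap 0 r t)).re) hαm hαc ?_ ?_
    (fun t => by positivity) (fun t => ?_) (Ico_subset_Icc_self ht)
  · simp only [hαdef, hper]; ring
  · simp only [hper]
  · have h1 := ((hF _ (hcm t)).comp t (hasDerivAt_circleMap 0 r t)).const_mul (exp (-(α a * I)))
    have h2 := (reCLM.hasFDerivAt.comp_hasDerivAt t h1)
    refine h2.congr_deriv ?_
    have : exp (-(α a * I)) * (exp (l (circleMap 0 r t)) * (circleMap 0 r t * I)) =
        ((r * Real.exp (l (circleMap 0 r t)).re : ℝ) : ℂ) * (exp ((α t - α a : ℝ) * I) * I) := by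
      have hαt : α t = t + (l (circleMap 0 r t)).im := rfl
      have hexp : exp (-(α a * I)) * exp (l (circleMap 0 r t)) * exp (t * I) =
          exp (l (circleMap 0 r t)).re * exp ((α t - α a : ℝ) * I) := by
        rw [← exp_add, ← exp_add, ← exp_add]
        congr 1
        conv_lhs => rw [← re_add_im (l (circleMap 0 r t))]
        rw [hαt]
        push_cast
        ring
      have hz : circleMap 0 r t = r * exp (t * I) := circleMap_zero r t
      calc _ = exp (-(α a * I)) * exp (l (circleMap 0 r t)) * exp (t * I) * (r * I) := by
            nth_rw 2 [hz]; ring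
        _ = _ := by rw [hexp]; push_cast; ring
    simp only [reCLM_apply]
    rw [this, re_ofReal_mul, mul_I_re, exp_ofReal_mul_I_im]
    ring

/-- A function with `F' = exp l` and `Re (1 + z F''/F') > 0` on the unit disk has convex image. -/
theorem convex_image_ball_of_re_pos {F l l' : ℂ → ℂ}
    (hF : ∀ z ∈ ball (0 : ℂ) 1, HasDerivAt F (exp (l z)) z)
    (hl : ∀ z ∈ ball (0 : ℂ) 1, HasDerivAt l (l' z) z)
    (hpos : ∀ z ∈ ball (0 : ℂ) 1, 0 < (1 + z * l' z).re) :
    Convex ℝ (F '' ball (0 : ℂ) 1) := by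
  have hr : ∀ r : ℝ, 0 < r → r < 1 → Convex ℝ (F '' ball (0 : ℂ) r) := fun r hr hr1 => by
    have hsub : closedBall (0 : ℂ) r ⊆ ball 0 1 := closedBall_subset_ball hr1
    have hd : DifferentiableOn ℂ F (closedBall 0 r) := fun z hz =>
      (hF z (hsub hz)).differentiableAt.differentiableWithinAt
    refine (isOpen_image_of_hasDerivAt_exp isOpen_ball fun z hz =>
      hF z (hsub (ball_subset_closedBall hz))).convex_of_forall_supporting fun b hb hbn => ?_
    have hcl : closure (F '' ball (0 : ℂ) r) ⊆ F '' closedBall 0 r :=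
      closure_minimal (image_mono ball_subset_closedBall)
        ((isCompact_closedBall 0 r).image_of_continuousOn hd.continuousOn).isClosed
    obtain ⟨ζ, hζ, rfl⟩ := hcl hb
    have hζs : ζ ∈ sphere (0 : ℂ) r := by
      rcases ball_union_sphere (x := (0 : ℂ)) (ε := r) ▸ hζ with h | h
      · exact absurd (mem_image_of_mem F h) hbn
      · exact h
    obtain ⟨c, hc, hle⟩ := exists_re_mul_le_of_mem_sphere hF hl hpos hr hr1 hζs
    refine ⟨reCLM.comp ((ContinuousLinearMap.mul ℝ ℂ) c), fun h0 => ?_, ?_⟩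
    · simpa [hc] using DFunLike.congr_fun h0 c⁻¹
    · rintro _ ⟨z, hz, rfl⟩
      exact re_le_of_forall_sphere_re_le hr (hd.const_mul c) hle hz
  rintro _ ⟨z, hz, rfl⟩ _ ⟨w, hw, rfl⟩ s t hs ht hst
  rw [mem_ball_zero_iff] at hz hw
  obtain ⟨r, hr0, hr1⟩ := exists_between (max_lt hz hw)
  have hzr := (le_max_left _ _).trans_lt hr0
  have hwr := (le_max_right _ _).trans_lt hr0
  exact image_mono (ball_subset_ball hr1.le) <| hr r ((norm_nonneg z).trans_lt hzr) hr1
    (mem_image_of_mem F (mem_ball_zero_iff.2 hzr)) (mem_image_of_mem F (mem_ball_zero_iff.2 hwr))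
    hs ht hst

/-- The Noshiro–Warschawski criterion: a function whose derivative has positive real part on a
convex set is injective there. -/
theorem injOn_of_re_deriv_pos {F F' : ℂ → ℂ} {s : Set ℂ} (hs : Convex ℝ s)
    (hF : ∀ z ∈ s, HasDerivAt F (F' z) z) (hpos : ∀ z ∈ s, 0 < (F' z).re) : InjOn F s := by
  intro a ha b hb hab
  by_contra hne
  have hmem : ∀ t ∈ Icc (0 : ℝ) 1, a + t * (b - a) ∈ s := fun t ht => by
    simpa using hs.add_smul_sub_mem ha hb ht
  have hd : ∀ t ∈ Icc (0 : ℝ) 1, HasDerivAt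
      (fun t : ℝ => (F (a + t * (b - a)) * (starRingEnd ℂ) (b - a)).re)
      (normSq (b - a) * (F' (a + t * (b - a))).re) t := fun t ht => by
    have h0 : HasDerivAt (fun t : ℝ => a + t * (b - a)) (b - a) t := by
      simpa using ((hasDerivAt_id t).ofReal_comp.mul_const (b - a)).const_add a
    have h1 := ((hF _ (hmem t ht)).comp t h0).mul_const ((starRingEnd ℂ) (b - a))
    refine (reCLM.hasFDerivAt.comp_hasDerivAt t h1).congr_deriv ?_
    rw [mul_assoc, mul_conj, mul_comm, reCLM_apply, re_ofReal_mul]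
  have hmono := strictMonoOn_of_deriv_pos (convex_Icc (0 : ℝ) 1)
    (fun t ht => (hd t ht).continuousAt.continuousWithinAt) fun t ht => by
      have ht := interior_subset ht
      rw [(hd t ht).deriv]
      exact mul_pos (normSq_pos.2 (sub_ne_zero.2 (Ne.symm hne))) (hpos _ (hmem t ht))
  have := hmono (left_mem_Icc.2 zero_le_one) (right_mem_Icc.2 zero_le_one) zero_lt_one
  simp [hab] at this

/-- The radial integral of a holomorphic function on the unit disk is a primitive of it. -/
theorem hasDerivAt_integral_radial {f : ℂ → ℂ} (hf : DifferentiableOn ℂ f (ball 0 1)) {z : ℂ}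
    (hz : z ∈ ball (0 : ℂ) 1) :
    HasDerivAt (fun z => ∫ t in (0 : ℝ)..1, z * f (z * t)) (f z) z := by
  obtain ⟨F, hF⟩ := hf.isExactOn_ball
  have heq : ∀ w ∈ ball (0 : ℂ) 1, ∫ t in (0 : ℝ)..1, w * f (w * t) = F w - F 0 := fun w hw => by
    have hmem : ∀ t ∈ uIcc (0 : ℝ) 1, w * t ∈ ball (0 : ℂ) 1 := fun t ht => by
      rw [uIcc_of_le zero_le_one] at ht
      rw [mem_ball_zero_iff] at hw ⊢
      rw [norm_mul, norm_real, Real.norm_of_nonneg ht.1]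
      exact (mul_le_of_le_one_right (norm_nonneg w) ht.2).trans_lt hw
    have hlin : ∀ t : ℝ, HasDerivAt (fun t : ℝ => w * t) w t := fun t => by
      simpa using (hasDerivAt_id t).ofReal_comp.const_mul w
    have := intervalIntegral.integral_eq_sub_of_hasDerivAt (a := 0) (b := 1)
      (f := fun t : ℝ => F (w * t)) (f' := fun t : ℝ => w * f (w * t))
      (fun t ht => ((hF _ (hmem t ht)).comp t (hlin t)).congr_deriv (mul_comm _ _)) ?_
    · simpa using this
    · refine ContinuousOn.intervalIntegrable (continuousOn_const.mul ?_)
      exact hf.continuousOn.comp (by fun_prop) hmem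
  refine ((hF z hz).sub_const (F 0)).congr_of_eventuallyEq ?_
  filter_upwards [isOpen_ball.mem_nhds hz] with w hw using heq w hw


/-- The Schwarz–Christoffel mapping `φ(z) = ∫₀^z (1-ζ^n)^(-2/n) dζ` of the unit disk
onto a regular `n`-gon is injective on the unit disk with convex image. -/
theorem polygon_mapping_injective_convex
    (n : ℕ) (hn : 3 ≤ n) (φ : ℂ → ℂ)
    (hφ : ∀ z, φ z = ∫ t in (0:ℝ)..1,
      z * ((1 : ℂ) - (z * (t : ℂ)) ^ n) ^ (-(2 / (n : ℂ)))) :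
    Set.InjOn φ (Metric.ball (0 : ℂ) 1) ∧
      Convex ℝ (φ '' Metric.ball (0 : ℂ) 1) := by
  have hn0 : (n : ℂ) ≠ 0 := by exact_mod_cast (by lia : n ≠ 0)
  have hpow : ∀ z ∈ ball (0 : ℂ) 1, ‖z ^ n‖ < 1 := fun z hz => by
    rw [norm_pow]
    exact pow_lt_one₀ (norm_nonneg z) (mem_ball_zero_iff.1 hz) (by lia)
  have hre : ∀ z ∈ ball (0 : ℂ) 1, 0 < (1 - z ^ n).re := fun z hz => by
    have := (re_le_norm (z ^ n)).trans_lt (hpow z hz)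
    simpa using this
  have hne : ∀ z ∈ ball (0 : ℂ) 1, 1 - z ^ n ≠ 0 := fun z hz h => by
    simpa [h] using hre z hz
  set l : ℂ → ℂ := fun z => log (1 - z ^ n) * (-(2 / (n : ℂ))) with hldef
  have hl : ∀ z ∈ ball (0 : ℂ) 1,
      HasDerivAt l (2 * z ^ (n - 1) / (1 - z ^ n)) z := fun z hz => by
    have h := (((hasDerivAt_pow n z).const_sub 1).clog (Or.inl (hre z hz))).mul_const
      (-(2 / (n : ℂ)))
    refine h.congr_deriv ?_
    have := hne z hz
    field_simp
  have hdiff : DifferentiableOn ℂ (fun z => exp (l z)) (ball 0 1) := fun z hz =>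
    (hl z hz).differentiableAt.cexp.differentiableWithinAt
  have hφ' : ∀ z ∈ ball (0 : ℂ) 1, HasDerivAt φ (exp (l z)) z := fun z hz => by
    refine (hasDerivAt_integral_radial hdiff hz).congr_of_eventuallyEq ?_
    filter_upwards [isOpen_ball.mem_nhds hz] with w hw
    rw [hφ]
    refine intervalIntegral.integral_congr fun t ht => ?_
    rw [uIcc_of_le zero_le_one] at ht
    have hmem : w * t ∈ ball (0 : ℂ) 1 := by
      rw [mem_ball_zero_iff] at hw ⊢
      rw [norm_mul, norm_real, Real.norm_of_nonneg ht.1]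
      exact (mul_le_of_le_one_right (norm_nonneg w) ht.2).trans_lt hw
    simp only [hldef, cpow_def_of_ne_zero (hne _ hmem)]
  constructor
  · refine injOn_of_re_deriv_pos (convex_ball 0 1) hφ' fun z hz => ?_
    have harg : |arg (1 - z ^ n)| < Real.pi / 2 := abs_arg_lt_pi_div_two_iff.2 (Or.inl (hre z hz))
    have him : (l z).im = -(2 / (n : ℝ) * arg (1 - z ^ n)) := by
      have : l z = ((-(2 / (n : ℝ)) : ℝ) : ℂ) * log (1 - z ^ n) := by
        simp only [hldef]; push_cast; ring
      rw [this, im_ofReal_mul, log_im]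
      ring
    have hn1 : 0 < 2 / (n : ℝ) := by positivity
    have hn2 : 2 / (n : ℝ) ≤ 1 := by
      have : (3 : ℝ) ≤ n := by exact_mod_cast hn
      rw [div_le_one (by linarith)]
      linarith
    have hlt : |(l z).im| < Real.pi / 2 := by
      rw [him, abs_neg, abs_mul, abs_of_pos hn1]
      exact (mul_le_of_le_one_left (abs_nonneg _) hn2).trans_lt harg
    rw [exp_re]
    exact mul_pos (Real.exp_pos _) (Real.cos_pos_of_mem_Ioo (abs_lt.1 hlt))
  · refine convex_image_ball_of_re_pos hφ' hl fun z hz => ?_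
    have hz' := hne z hz
    have h1 : 1 + z * (2 * z ^ (n - 1) / (1 - z ^ n)) = (1 + z ^ n) / (1 - z ^ n) := by
      have : z ^ n = z * z ^ (n - 1) := (mul_pow_sub_one (by lia) z).symm
      field_simp
      rw [this]
      ring
    have h2 : normSq (z ^ n) < 1 := by
      rw [normSq_eq_norm_sq]
      exact pow_lt_one₀ (norm_nonneg _) (hpow z hz) two_ne_zero
    have h3 : 0 < normSq (1 - z ^ n) := normSq_pos.2 hz'
    rw [h1, div_re, ← add_div]
    refine div_pos ?_ h3
    rw [normSq_apply] at h2
    simp only [add_re, sub_re, add_im, sub_im, one_re, one_im]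
    nlinarith
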